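/- arXiv:2006.02511 — 2 statements merged into one kernel-verified Lean document; each statement's English description precedes it below -/
import Mathlib

section
/- With the data below (which hold for the first split decomposition of a tridiagonal system of q-Racah type), the following identities hold in End(V): a W^{-1}KW − qI = K(aI − q WK^{-1}W^{-1}) and a W^{-1}KW − q^{-1}I = (aI − q^{-1} WK^{-1}W^{-1})K. -/
/-- `T` acts on each successive quotient `Φ j / Φ (j + 1)` of the filtration as the scalar `p j`. -/
def IsTriangular {F V : Type*} [Field F] [AddCommGroup V] [Module F V]
    (Φ : ℕ → Submodule F V) (T : Module.End F V) (p : ℕ → F) : Prop :=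
  ∀ j, ∀ v ∈ Φ j, T v - p j • v ∈ Φ (j + 1)

namespace IsTriangular

variable {F V : Type*} [Field F] [AddCommGroup V] [Module F V]
  {Φ : ℕ → Submodule F V} {S T : Module.End F V} {p r : ℕ → F}

theorem apply_mem (hT : IsTriangular Φ T p) (hΦ : Antitone Φ) {j : ℕ} {v : V} (hv : v ∈ Φ j) :
    T v ∈ Φ j := by
  have h := Submodule.add_mem _ (hΦ j.le_succ (hT j v hv)) (Submodule.smul_mem _ (p j) hv)
  rwa [sub_add_cancel] at h

theorem one : IsTriangular Φ 1 fun _ => 1 := fun j v _ => by simp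

theorem add (hS : IsTriangular Φ S p) (hT : IsTriangular Φ T r) :
    IsTriangular Φ (S + T) fun j => p j + r j := fun j v hv => by
  have h := Submodule.add_mem _ (hS j v hv) (hT j v hv)
  rw [show (S + T) v - (p j + r j) • v = S v - p j • v + (T v - r j • v) by
    rw [LinearMap.add_apply]; module]
  exact h

theorem smul (c : F) (hT : IsTriangular Φ T p) :
    IsTriangular Φ (c • T) fun j => c * p j := fun j v hv => by
  rw [show (c • T) v - (c * p j) • v = c • (T v - p j • v) by
    rw [LinearMap.smul_apply]; module]
  exact Submodule.smul_mem _ _ (hT j v hv)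

theorem sub (hS : IsTriangular Φ S p) (hT : IsTriangular Φ T r) :
    IsTriangular Φ (S - T) fun j => p j - r j := fun j v hv => by
  have h := Submodule.sub_mem _ (hS j v hv) (hT j v hv)
  rw [show (S - T) v - (p j - r j) • v = S v - p j • v - (T v - r j • v) by
    rw [LinearMap.sub_apply]; module]
  exact h

theorem mul (hΦ : Antitone Φ) (hS : IsTriangular Φ S p) (hT : IsTriangular Φ T r) :
    IsTriangular Φ (S * T) fun j => p j * r j := fun j v hv => by
  have h := Submodule.add_mem _ (hS.apply_mem hΦ (hT j v hv))
    (Submodule.smul_mem _ (r j) (hS j v hv))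
  rw [map_sub, map_smul] at h
  rw [show (S * T) v - (p j * r j) • v =
    S (T v) - r j • S v + r j • (S v - p j • v) by rw [Module.End.mul_apply]; module]
  exact h

end IsTriangular

/-- Two operators intertwined by `L` that act triangularly on a finite descending filtration, with
distinct diagonal entries wherever `L` could be nonzero, force `L = 0`. -/
theorem eq_zero_of_intertwines_filtration {F V : Type*} [Field F] [AddCommGroup V] [Module F V]
    (d m : ℕ) {Φ : ℕ → Submodule F V} (hΦ0 : Φ 0 = ⊤) (hΦd : ∀ i, d < i → Φ i = ⊥)
    {L P Q : Module.End F V} {p r : ℕ → F}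
    (hP : IsTriangular Φ P p) (hQ : IsTriangular Φ Q r)
    (hL : ∀ j, ∀ v ∈ Φ j, L v ∈ Φ (j + m)) (hLPQ : L * P = Q * L)
    (hpr : ∀ i j, i ≤ d → j + m ≤ i → p j ≠ r i) : L = 0 := by
  have key : ∀ k j, ∀ v ∈ Φ j, L v ∈ Φ (j + m + k) := by
    intro k
    induction k with
    | zero => exact hL
    | succ k ih =>
      intro j v hv
      rcases Nat.lt_or_ge d (j + m + k) with h | h
      · have h0 := ih j v hv
        rw [hΦd _ h, Submodule.mem_bot] at h0
        rw [h0]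
        exact Submodule.zero_mem _
      · have h1 : L (P v - p j • v) ∈ Φ (j + m + k + 1) := by
          have := ih (j + 1) _ (hP j v hv)
          rwa [show j + 1 + m + k = j + m + k + 1 by ring] at this
        have h2 := Submodule.sub_mem _ (hQ _ _ (ih j v hv)) h1
        have h3 : L (P v) = Q (L v) := LinearMap.congr_fun hLPQ v
        rw [map_sub, h3, map_smul, sub_sub_sub_cancel_left, ← sub_smul] at h2
        exact (Submodule.smul_mem_iff _ (sub_ne_zero.mpr (hpr _ j h (by omega)))).mp h2
  ext v
  have h := key (d + 1) 0 v (by rw [hΦ0]; trivial)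
  rw [hΦd _ (by omega), Submodule.mem_bot] at h
  simpa using h

section Spectral

variable {F V : Type*} [Field F] [AddCommGroup V] [Module F V] {d : ℕ} {E : ℕ → Module.End F V}

/-- The vectors killed by every `E i` with `i < j` and `i ≤ d`. -/
def projFlag (d : ℕ) (E : ℕ → Module.End F V) (j : ℕ) : Submodule F V :=
  ⨅ i ∈ {i | i ≤ d ∧ i < j}, LinearMap.ker (E i)

theorem mem_projFlag {j : ℕ} {v : V} :
    v ∈ projFlag d E j ↔ ∀ i, i ≤ d → i < j → E i v = 0 := by
  simp [projFlag]

theorem projFlag_antitone : Antitone (projFlag d E) := fun _ _ hij _ hv =>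
  mem_projFlag.mpr fun k hk hki => mem_projFlag.mp hv k hk (hki.trans_le hij)

theorem projFlag_zero : projFlag d E 0 = ⊤ := by
  ext v
  simp [mem_projFlag]

theorem projFlag_eq_bot (hEsum : ∑ i ∈ Finset.range (d + 1), E i = 1) {j : ℕ} (hj : d < j) :
    projFlag d E j = ⊥ := by
  rw [Submodule.eq_bot_iff]
  intro v hv
  have h := LinearMap.congr_fun hEsum v
  rw [Module.End.one_apply, LinearMap.sum_apply] at h
  rw [← h]
  refine Finset.sum_eq_zero fun i hi => mem_projFlag.mp hv i ?_ ?_ <;>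
    have := Finset.mem_range.mp hi <;> omega

theorem proj_mul_sum_smul
    (hEE : ∀ i j : ℕ, i ≤ d → j ≤ d → E i * E j = if i = j then E i else 0) (f : ℕ → F)
    {i : ℕ} (hi : i ≤ d) : E i * ∑ k ∈ Finset.range (d + 1), f k • E k = f i • E i := by
  rw [Finset.mul_sum, Finset.sum_eq_single i]
  · rw [mul_smul_comm, hEE i i hi hi, if_pos rfl]
  · intro k hk hki
    have := Finset.mem_range.mp hk
    rw [mul_smul_comm, hEE i k hi (by omega), if_neg hki.symm, smul_zero]
  · intro h
    exact absurd (Finset.mem_range.mpr (by omega)) h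

theorem sum_smul_mul_sum_smul
    (hEE : ∀ i j : ℕ, i ≤ d → j ≤ d → E i * E j = if i = j then E i else 0) (f g : ℕ → F) :
    (∑ k ∈ Finset.range (d + 1), f k • E k) * (∑ k ∈ Finset.range (d + 1), g k • E k) =
      ∑ k ∈ Finset.range (d + 1), (f k * g k) • E k := by
  rw [Finset.sum_mul]
  refine Finset.sum_congr rfl fun k hk => ?_
  have := Finset.mem_range.mp hk
  rw [smul_mul_assoc, proj_mul_sum_smul hEE g (by omega), smul_smul]

theorem sum_smul_apply_mem_projFlag
    (hEE : ∀ i j : ℕ, i ≤ d → j ≤ d → E i * E j = if i = j then E i else 0) {f : ℕ → F}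
    {j m : ℕ} (hf : ∀ i, j ≤ i → i < j + m → f i = 0) {v : V} (hv : v ∈ projFlag d E j) :
    (∑ k ∈ Finset.range (d + 1), f k • E k) v ∈ projFlag d E (j + m) := by
  rw [mem_projFlag]
  intro i hi him
  rw [← Module.End.mul_apply, proj_mul_sum_smul hEE f hi, LinearMap.smul_apply]
  rcases Nat.lt_or_ge i j with h | h
  · rw [mem_projFlag.mp hv i hi h, smul_zero]
  · rw [hf i h him, zero_smul]

theorem sum_sub_const_smul_apply (hEsum : ∑ i ∈ Finset.range (d + 1), E i = 1)
    (f : ℕ → F) (c : F) (v : V) :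
    (∑ k ∈ Finset.range (d + 1), (f k - c) • E k) v =
      (∑ k ∈ Finset.range (d + 1), f k • E k) v - c • v := by
  simp only [sub_smul, Finset.sum_sub_distrib, ← Finset.smul_sum, hEsum]
  simp

theorem isTriangular_sum_smul
    (hEE : ∀ i j : ℕ, i ≤ d → j ≤ d → E i * E j = if i = j then E i else 0)
    (hEsum : ∑ i ∈ Finset.range (d + 1), E i = 1) (f : ℕ → F) :
    IsTriangular (projFlag d E) (∑ k ∈ Finset.range (d + 1), f k • E k) f := fun j v hv => by
  rw [← sum_sub_const_smul_apply hEsum]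
  refine sum_smul_apply_mem_projFlag hEE (fun i h1 h2 => ?_) hv
  rw [show i = j by omega, sub_self]

theorem sum_smul_congr_mod_projFlag
    (hEE : ∀ i j : ℕ, i ≤ d → j ≤ d → E i * E j = if i = j then E i else 0)
    (hEsum : ∑ i ∈ Finset.range (d + 1), E i = 1) (f θ : ℕ → F) {j : ℕ}
    (hθ : θ (j + 1) - θ j ≠ 0) {v : V} (hv : v ∈ projFlag d E j) :
    (∑ k ∈ Finset.range (d + 1), f k • E k) v - (f j • v +
      ((f (j + 1) - f j) / (θ (j + 1) - θ j)) •
        ((∑ k ∈ Finset.range (d + 1), θ k • E k) v - θ j • v)) ∈ projFlag d E (j + 2) := by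
  have h : (∑ k ∈ Finset.range (d + 1), ((f k - f j) -
      ((f (j + 1) - f j) / (θ (j + 1) - θ j)) * (θ k - θ j)) • E k) v ∈
      projFlag d E (j + 2) := by
    refine sum_smul_apply_mem_projFlag hEE (fun i h1 h2 => ?_) hv
    obtain rfl | rfl : i = j ∨ i = j + 1 := by omega
    · simp
    · rw [div_mul_cancel₀ _ hθ, sub_self]
  have h' (c : F) : ∑ k ∈ Finset.range (d + 1), (f k - f j - c * (θ k - θ j)) • E k =
      ∑ k ∈ Finset.range (d + 1), (f k - f j) • E k -
        c • ∑ k ∈ Finset.range (d + 1), (θ k - θ j) • E k := by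
    rw [Finset.smul_sum, ← Finset.sum_sub_distrib]
    exact Finset.sum_congr rfl fun k _ => by rw [smul_smul, ← sub_smul]
  rw [h', LinearMap.sub_apply, LinearMap.smul_apply, sum_sub_const_smul_apply hEsum,
    sum_sub_const_smul_apply hEsum, sub_sub] at h
  exact h

end Spectral

section Algebra

variable {F S : Type*} [Field F] [Ring S] [Algebra F S]

theorem split_quadratic_relation {q a : F} (hq : q ≠ 0) (ha : a ≠ 0) {K L R : S}
    (hKL : K * L = 1) (hLK : L * K = 1) (hRK : R * K = q ^ 2 • (K * R)) :
    q • (K * (a • K + a⁻¹ • L + R)) - q⁻¹ • ((a • K + a⁻¹ • L + R) * K) =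
      (a * (q - q⁻¹)) • (K * K) + (a⁻¹ * (q - q⁻¹)) • (1 : S) := by
  simp only [mul_add, add_mul, smul_mul_assoc, mul_smul_comm, hKL, hLK, hRK]
  match_scalars <;> field_simp <;> ring

theorem quadratic_relation_conj {q b c : F} {A K W Z : S} (hWZ : W * Z = 1) (hAW : A * W = W * A)
    (hAZ : A * Z = Z * A)
    (h : q • (K * A) - q⁻¹ • (A * K) = b • (K * K) + c • (1 : S)) (hZW : Z * W = 1) :
    q • ((Z * K * W) * A) - q⁻¹ • (A * (Z * K * W)) =
      b • ((Z * K * W) * (Z * K * W)) + c • (1 : S) := by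
  have h1 : Z * K * W * A = Z * (K * A) * W := by
    rw [mul_assoc, ← hAW]; simp only [mul_assoc]
  have h2 : A * (Z * K * W) = Z * (A * K) * W := by
    simp only [← mul_assoc, hAZ]
  have h3 : (Z * K * W) * (Z * K * W) = Z * (K * K) * W := by
    calc _ = Z * K * (W * Z) * K * W := by simp only [mul_assoc]
      _ = _ := by rw [hWZ, mul_one]; simp only [mul_assoc]
  have h4 : (1 : S) = Z * 1 * W := by rw [mul_one, hZW]
  rw [h1, h2, h3, h4]
  calc _ = Z * (q • (K * A) - q⁻¹ • (A * K)) * W := by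
        simp only [mul_sub, sub_mul, mul_smul_comm, smul_mul_assoc]
    _ = _ := by
        rw [h]; simp only [mul_add, add_mul, mul_smul_comm, smul_mul_assoc]

theorem split_intertwines {q a : F} (hq : q ≠ 0) (ha : a ≠ 0) {A K L R X : S}
    (hKL : K * L = 1) (hLK : L * K = 1) (hRK : R * K = q ^ 2 • (K * R))
    (hA : A = a • K + a⁻¹ • L + R)
    (hX : q • (X * A) - q⁻¹ • (A * X) =
      (a * (q - q⁻¹)) • (X * X) + (a⁻¹ * (q - q⁻¹)) • (1 : S)) :
    ((1 - (q * a) • K) * (X - K) + q • (K * R)) * (q • A - (a * (q - q⁻¹)) • X) =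
      (q⁻¹ • A + (a * (q - q⁻¹)) • K) * ((1 - (q * a) • K) * (X - K) + q • (K * R)) := by
  have hRK' : ∀ Z, R * (K * Z) = q ^ 2 • (K * (R * Z)) := fun Z => by
    rw [← mul_assoc, hRK, smul_mul_assoc, mul_assoc]
  have hKL' : ∀ Z, K * (L * Z) = Z := fun Z => by rw [← mul_assoc, hKL, one_mul]
  have hLK' : ∀ Z, L * (K * Z) = Z := fun Z => by rw [← mul_assoc, hLK, one_mul]
  have hRL : R * L = (q ^ 2)⁻¹ • (L * R) := by
    have h1 : L * (R * K) * L = q ^ 2 • (R * L) := by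
      rw [hRK, mul_smul_comm, hLK', smul_mul_assoc]
    have h2 : L * (R * K) * L = L * R := by
      simp only [mul_assoc, hKL, mul_one]
    rw [← h2, h1, inv_smul_smul₀ (pow_ne_zero 2 hq)]
  set M : S := 1 - (q * a) • K with hM
  set B : S := M * K - q • (K * R) with hB
  set c : F := a * (q - q⁻¹) with hc
  have hMA : q⁻¹ • (M * A) + c • B = (q⁻¹ • A + c • K) * M := by
    rw [hB, hM, hA, hc]
    simp only [mul_add, add_mul, mul_sub, sub_mul, smul_mul_assoc, mul_smul_comm,
      hKL, hLK, hRK, one_mul, mul_one]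
    match_scalars <;> field_simp <;> ring
  have hBA : q • (B * A) = (q⁻¹ • A + c • K) * B + (a⁻¹ * (q - q⁻¹)) • M := by
    rw [hB, hM, hA, hc]
    simp only [mul_add, add_mul, mul_sub, sub_mul, smul_mul_assoc, mul_smul_comm, mul_assoc,
      hKL, hLK, hRK, hRK', hKL', hLK', hRL, one_mul, mul_one, smul_add, smul_sub]
    match_scalars <;> field_simp <;> ring
  have hG : M * (X - K) + q • (K * R) = M * X - B := by
    rw [hB]; noncomm_ring
  rw [hG]
  have h1 : M * (q • (X * A)) = M * (q⁻¹ • (A * X) + c • (X * X) + (a⁻¹ * (q - q⁻¹)) • (1 : S)) := by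
    congr 1
    rw [add_assoc, ← hX]
    abel
  have h2 := congrArg (· * X) hMA
  simp only [add_mul, smul_mul_assoc, mul_add, mul_smul_comm, mul_assoc, mul_one] at h1 h2 hBA ⊢
  simp only [sub_mul, mul_sub, mul_smul_comm, mul_assoc, h1, hBA, smul_sub]
  rw [← sub_eq_zero] at h2 ⊢
  rw [← h2]
  module

theorem split_intertwines_symm {q a : F} {K R X : S} (hq : q ≠ 0)
    (hRK : R * K = q ^ 2 • (K * R)) :
    ((1 - (q * a) • K) * (X - K) + q • (K * R)) * (1 - (q⁻¹ * a) • K) =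
      (1 - (q * a) • K) * ((X - K) * (1 - (q⁻¹ * a) • K) + q⁻¹ • (R * K)) := by
  simp only [mul_add, add_mul, mul_sub, sub_mul, smul_mul_assoc, mul_smul_comm, mul_assoc,
    hRK, one_mul, mul_one, smul_sub]
  match_scalars <;> field_simp

theorem first_identity_of_split {q a : F} (ha : a ≠ 0) {A K L R X Y : S}
    (hKL : K * L = 1) (hA : A = a • K + a⁻¹ • L + R) (hAXY : A = a • X + a⁻¹ • Y)
    (h : (1 - (q * a) • K) * (X - K) + q • (K * R) = 0) :
    a • X - q • 1 = K * (a • 1 - q • Y) := by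
  have hY : Y = a • A - a ^ 2 • X := by
    rw [hAXY]; match_scalars <;> field_simp; simp
  rw [← sub_eq_zero, ← smul_zero a, ← h, hY, hA]
  simp only [mul_add, mul_sub, sub_mul, smul_mul_assoc, mul_smul_comm, mul_one, one_mul, hKL]
  match_scalars <;> field_simp <;> ring

theorem second_identity_of_split {q a : F} (ha : a ≠ 0) {A K L R X Y : S}
    (hLK : L * K = 1) (hA : A = a • K + a⁻¹ • L + R) (hAXY : A = a • X + a⁻¹ • Y)
    (h : (X - K) * (1 - (q⁻¹ * a) • K) + q⁻¹ • (R * K) = 0) :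
    a • X - q⁻¹ • 1 = (a • 1 - q⁻¹ • Y) * K := by
  have hY : Y = a • A - a ^ 2 • X := by
    rw [hAXY]; match_scalars <;> field_simp; simp
  rw [← sub_eq_zero, ← smul_zero a, ← h, hY, hA]
  simp only [add_mul, mul_sub, sub_mul, smul_mul_assoc, mul_smul_comm, mul_one, one_mul, hLK]
  match_scalars <;> field_simp <;> ring

end Algebra

theorem conj_subdiagonal_coeff_eq_zero {F : Type*} [Field F] {q a k t s θ₀ θ₁ : F} (hq : q ≠ 0)
    (ha : a ≠ 0) (hk : k ≠ 0) (ht : t ≠ 0) (hs : s = -(a * q * k) * t)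
    (hθ₀ : θ₀ = a * (q ^ 2 * k) + a⁻¹ * (q ^ 2 * k)⁻¹) (hθ₁ : θ₁ = a * k + a⁻¹ * k⁻¹)
    (hθ : θ₁ - θ₀ ≠ 0) :
    (1 - q * a * k) * (t * (q ^ 2 * k) * ((s⁻¹ - t⁻¹) / (θ₁ - θ₀)) +
      (s - t) / (θ₁ - θ₀) * k * s⁻¹) + q * k = 0 := by
  have h : (1 - q * a * k) * (t * (q ^ 2 * k) * (s⁻¹ - t⁻¹) + (s - t) * k * s⁻¹) +
      q * k * (θ₁ - θ₀) = 0 := by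
    rw [hs, hθ₀, hθ₁]
    field_simp
    ring
  have h' := congrArg (· / (θ₁ - θ₀)) h
  simp only [zero_div] at h'
  rw [← h']
  field_simp

theorem intertwiner_weights_ne {F : Type*} [Field F] {q a x y : F} (hq : q ≠ 0) (ha : a ≠ 0)
    (hx : x ≠ 0) (hy : y ≠ 0) (h1 : y ≠ q ^ 2 * x) (h2 : a ^ 2 * x * y ≠ 1) :
    q * (a * y + a⁻¹ * y⁻¹) - a * (q - q⁻¹) * y ≠
      q⁻¹ * (a * x + a⁻¹ * x⁻¹) + a * (q - q⁻¹) * x := by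
  intro h
  have h3 : (y - q ^ 2 * x) * (a ^ 2 * x * y - 1) = 0 := by
    field_simp at h
    linear_combination h
  rcases mul_eq_zero.mp h3 with h4 | h4
  · exact h1 (sub_eq_zero.mp h4)
  · exact h2 (sub_eq_zero.mp h4)


theorem stmt18
    {F : Type*} [Field F] {V : Type*} [AddCommGroup V] [Module F V]
    [FiniteDimensional F V] [Nontrivial V]
    (q a : F) (hq0 : q ≠ 0) (ha0 : a ≠ 0) (hq4 : q ^ 4 ≠ 1)
    (d : ℕ) (hd : 1 ≤ d)
    (hq2i : ∀ i : ℕ, 1 ≤ i → i ≤ d → q ^ (2 * i) ≠ 1)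
    (ha2 : ∀ j : ℤ, 1 - (d : ℤ) ≤ j → j ≤ (d : ℤ) - 1 → a ^ 2 ≠ q ^ (2 * j))
    (θ : ℕ → F)
    (hθ : ∀ i : ℕ, i ≤ d → θ i = a * q ^ ((d : ℤ) - 2 * (i : ℤ)) + a⁻¹ * q ^ (2 * (i : ℤ) - (d : ℤ)))
    (hθdist : ∀ i j : ℕ, i ≤ d → j ≤ d → i ≠ j → θ i ≠ θ j)
    (A : Module.End F V) (E : ℕ → Module.End F V)
    (hEE : ∀ i j : ℕ, i ≤ d → j ≤ d → E i * E j = if i = j then E i else 0)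
    (hEsum : ∑ i ∈ Finset.range (d + 1), E i = 1)
    (hAE : A = ∑ i ∈ Finset.range (d + 1), θ i • E i)
    (hEne : ∀ i : ℕ, i ≤ d → E i ≠ 0)
    (t : ℕ → F)
    (ht : ∀ i : ℕ, i ≤ d → t i = (-1 : F) ^ i * a ^ i * q ^ (i * (d - i)))
    (W Winv : Module.End F V)
    (hW : W = ∑ i ∈ Finset.range (d + 1), t i • E i)
    (hWinv : Winv = ∑ i ∈ Finset.range (d + 1), (t i)⁻¹ • E i)
    (U : ℕ → Submodule F V)
    (hUne : ∀ i : ℕ, i ≤ d → U i ≠ ⊥)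
    (hUzero : ∀ i : ℕ, d < i → U i = ⊥)
    (hUind : iSupIndep U)
    (hUtop : (⨆ i ∈ Finset.range (d + 1), U i) = ⊤)
    (hUsplit : ∀ i : ℕ, i ≤ d →
      (⨆ j ∈ Finset.Icc i d, U j) = ⨆ j ∈ Finset.Icc i d, LinearMap.range (E j))
    (hAU : ∀ i : ℕ, i < d → ∀ v ∈ U i, (A - θ i • 1) v ∈ U (i + 1))
    (hAUd : ∀ v ∈ U d, (A - θ d • 1) v = 0)
    (K Kinv : Module.End F V)
    (hKKinv : K * Kinv = 1) (hKinvK : Kinv * K = 1)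
    (hKU : ∀ i : ℕ, i ≤ d → ∀ v ∈ U i, K v = (q ^ ((d : ℤ) - 2 * (i : ℤ))) • v)
    (hAKW : A = a • (Winv * K * W) + a⁻¹ • (W * Kinv * Winv)) :
    a • (Winv * K * W) - q • 1 = K * (a • 1 - q • (W * Kinv * Winv)) ∧
    a • (Winv * K * W) - q⁻¹ • 1 = (a • 1 - q⁻¹ • (W * Kinv * Winv)) * K := by
  set κ : ℕ → F := fun j => q ^ ((d : ℤ) - 2 * (j : ℤ)) with hκ
  have hκ0 : ∀ j, κ j ≠ 0 := fun j => zpow_ne_zero _ hq0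
  have hκs : ∀ j, κ j = q ^ 2 * κ (j + 1) := fun j => by
    simp only [hκ]
    rw [← zpow_natCast, ← zpow_add₀ hq0]
    congr 1
    push_cast
    ring
  have hθκ : ∀ i ≤ d, θ i = a * κ i + a⁻¹ * (κ i)⁻¹ := fun i hi => by
    rw [hθ i hi]
    simp only [hκ]
    rw [← zpow_neg, neg_sub]
  have ht0 : ∀ i ≤ d, t i ≠ 0 := fun i hi => by
    rw [ht i hi]
    exact mul_ne_zero (mul_ne_zero (pow_ne_zero _ (neg_ne_zero.mpr one_ne_zero))
      (pow_ne_zero _ ha0)) (pow_ne_zero _ hq0)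
  have hts : ∀ j, j < d → t (j + 1) = -(a * q * κ (j + 1)) * t j := fun j hj => by
    obtain ⟨n, rfl⟩ : ∃ n, d = j + 1 + n := ⟨d - (j + 1), by omega⟩
    have h1 : q ^ j * (q * κ (j + 1)) = q ^ n := by
      simp only [hκ]
      rw [← zpow_natCast, ← zpow_natCast, ← zpow_one_add₀ hq0, ← zpow_add₀ hq0]
      congr 1
      push_cast
      ring
    rw [ht j hj.le, ht (j + 1) hj, show j + 1 + n - (j + 1) = n by omega,
      show j + 1 + n - j = n + 1 by omega, add_mul, mul_add, one_mul, mul_one,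
      pow_add q (j * n) n, ← h1]
    ring
  have hWZ : W * Winv = 1 := by
    rw [hW, hWinv, sum_smul_mul_sum_smul hEE, ← hEsum]
    refine Finset.sum_congr rfl fun i hi => ?_
    rw [mul_inv_cancel₀ (ht0 i (by have := Finset.mem_range.mp hi; omega)), one_smul]
  have hZW : Winv * W = 1 := by
    rw [hW, hWinv, sum_smul_mul_sum_smul hEE, ← hEsum]
    refine Finset.sum_congr rfl fun i hi => ?_
    rw [inv_mul_cancel₀ (ht0 i (by have := Finset.mem_range.mp hi; omega)), one_smul]
  have hAW : A * W = W * A := by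
    rw [hW, hAE, sum_smul_mul_sum_smul hEE, sum_smul_mul_sum_smul hEE]
    simp only [mul_comm]
  have hAZ : A * Winv = Winv * A := by
    rw [hWinv, hAE, sum_smul_mul_sum_smul hEE, sum_smul_mul_sum_smul hEE]
    simp only [mul_comm]
  set Φ := projFlag d E with hΦ
  have hanti : Antitone Φ := projFlag_antitone
  have hΦd : ∀ i, d < i → Φ i = ⊥ := fun i hi => projFlag_eq_bot hEsum hi
  have hΦle : ∀ j ≤ d, Φ j ≤ ⨆ i ∈ Finset.Icc j d, U i := fun j hj v hv => by
    rw [hUsplit j hj]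
    have h := LinearMap.congr_fun hEsum v
    rw [Module.End.one_apply, LinearMap.sum_apply] at h
    rw [← h]
    refine Submodule.sum_mem _ fun i hi => ?_
    have := Finset.mem_range.mp hi
    rcases Nat.lt_or_ge i j with hij | hij
    · rw [mem_projFlag.mp hv i (by omega) hij]
      exact Submodule.zero_mem _
    · exact Submodule.mem_iSup_of_mem i (Submodule.mem_iSup_of_mem
        (Finset.mem_Icc.mpr ⟨hij, by omega⟩) ⟨v, rfl⟩)
  have hUΦ : ∀ j ≤ d, U j ≤ Φ j := fun j hj => by
    have h1 : U j ≤ ⨆ i ∈ Finset.Icc j d, U i :=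
      le_iSup₂_of_le j (Finset.mem_Icc.mpr ⟨le_rfl, hj⟩) le_rfl
    rw [hUsplit j hj] at h1
    refine h1.trans (iSup₂_le fun i hi => ?_)
    obtain ⟨hji, hid⟩ := Finset.mem_Icc.mp hi
    rintro _ ⟨v, rfl⟩
    refine mem_projFlag.mpr fun k hk hkj => ?_
    rw [← Module.End.mul_apply, hEE k i hk hid, if_neg (by omega), LinearMap.zero_apply]
  have hraise : ∀ (m : ℕ) (T : Module.End F V), (∀ i ≤ d, ∀ u ∈ U i, T u ∈ Φ (i + m)) →
      ∀ j, ∀ v ∈ Φ j, T v ∈ Φ (j + m) := fun m T hT j v hv => by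
    rcases Nat.lt_or_ge d j with hj | hj
    · rw [hΦd j hj, Submodule.mem_bot] at hv
      rw [hv, map_zero]
      exact Submodule.zero_mem _
    · have h : (⨆ i ∈ Finset.Icc j d, U i) ≤ (Φ (j + m)).comap T :=
        iSup₂_le fun i hi u hu => by
          obtain ⟨hji, hid⟩ := Finset.mem_Icc.mp hi
          exact hanti (by omega) (hT i hid u hu)
      exact h (hΦle j hj hv)
  have hzero : ∀ T : Module.End F V, (∀ i ≤ d, ∀ u ∈ U i, T u = 0) → T = 0 := fun T hT => by
    have h : (⨆ i ∈ Finset.range (d + 1), U i) ≤ LinearMap.ker T :=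
      iSup₂_le fun i hi u hu => hT i (by have := Finset.mem_range.mp hi; omega) u hu
    rw [hUtop, top_le_iff] at h
    exact LinearMap.ker_eq_top.mp h
  have htri : ∀ (T : Module.End F V) (p : ℕ → F), (∀ i ≤ d, ∀ u ∈ U i, T u = p i • u) →
      IsTriangular Φ T p := fun T p hT j v hv => by
    rcases Nat.lt_or_ge d j with hj | hj
    · rw [hΦd j hj, Submodule.mem_bot] at hv
      simp [hv]
    · have h : (⨆ i ∈ Finset.Icc j d, U i) ≤ (Φ (j + 1)).comap (T - p j • 1) :=
        iSup₂_le fun i hi u hu => by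
          obtain ⟨hji, hid⟩ := Finset.mem_Icc.mp hi
          rw [Submodule.mem_comap, LinearMap.sub_apply, LinearMap.smul_apply,
            Module.End.one_apply, hT i hid u hu, ← sub_smul]
          rcases hji.eq_or_lt with rfl | hlt
          · rw [sub_self, zero_smul]
            exact Submodule.zero_mem _
          · exact Submodule.smul_mem _ _ (hanti hlt (hUΦ i hid hu))
      exact h (hΦle j hj hv)
  have hLU : ∀ i ≤ d, ∀ u ∈ U i, Kinv u = (κ i)⁻¹ • u := fun i hi u hu => by
    have h := congrArg Kinv (hKU i hi u hu)
    rw [← Module.End.mul_apply, hKinvK, Module.End.one_apply, map_smul] at h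
    rw [eq_inv_smul_iff₀ (hκ0 i)]
    exact h.symm
  obtain ⟨R, hR⟩ : ∃ R, R = A - a • K - a⁻¹ • Kinv := ⟨_, rfl⟩
  have hA : A = a • K + a⁻¹ • Kinv + R := by rw [hR]; abel
  have hRA : ∀ i ≤ d, ∀ u ∈ U i, R u = A u - θ i • u := fun i hi u hu => by
    rw [hR, LinearMap.sub_apply, LinearMap.sub_apply, LinearMap.smul_apply, LinearMap.smul_apply,
      hKU i hi u hu, hLU i hi u hu, hθκ i hi]
    module
  have hRU : ∀ i ≤ d, ∀ u ∈ U i, R u ∈ U (i + 1) := fun i hi u hu => by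
    rw [hRA i hi u hu]
    rcases hi.eq_or_lt with rfl | hlt
    · have h := hAUd u hu
      rw [LinearMap.sub_apply, LinearMap.smul_apply, Module.End.one_apply] at h
      rw [h]
      exact Submodule.zero_mem _
    · exact hAU i hlt u hu
  have hKU' : ∀ i, ∀ u ∈ U i, K u = κ i • u := fun i u hu => by
    rcases Nat.lt_or_ge d i with hi | hi
    · rw [hUzero i hi, Submodule.mem_bot] at hu
      simp [hu]
    · exact hKU i hi u hu
  have hRK : R * K = q ^ 2 • (K * R) := by
    rw [← sub_eq_zero]
    refine hzero _ fun i hi u hu => ?_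
    rw [LinearMap.sub_apply, LinearMap.smul_apply, Module.End.mul_apply, Module.End.mul_apply,
      hKU' i u hu, map_smul, hKU' _ _ (hRU i hi u hu), smul_smul, ← hκs, sub_self]
  have hKt : IsTriangular Φ K κ := htri K κ hKU
  have hAt : IsTriangular Φ A θ := hAE ▸ isTriangular_sum_smul hEE hEsum θ
  have hWt : IsTriangular Φ W t := hW ▸ isTriangular_sum_smul hEE hEsum t
  have hZt : IsTriangular Φ Winv fun i => (t i)⁻¹ :=
    hWinv ▸ isTriangular_sum_smul hEE hEsum fun i => (t i)⁻¹
  set X := Winv * K * W with hX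
  have hXraise : ∀ j, ∀ v ∈ Φ j, (X - K) v ∈ Φ (j + 1) := fun j v hv => by
    rcases Nat.lt_or_ge d j with hj | hj
    · rw [hΦd j hj, Submodule.mem_bot] at hv
      rw [hv, map_zero]
      exact Submodule.zero_mem _
    · have h := (((hZt.mul hanti hKt).mul hanti hWt).sub hKt) j v hv
      beta_reduce at h
      rwa [show (t j)⁻¹ * κ j * t j - κ j = 0 by
        rw [mul_right_comm, inv_mul_cancel₀ (ht0 j hj), one_mul, sub_self], zero_smul,
        sub_zero] at h
  have hXt : IsTriangular Φ X κ := fun j v hv => by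
    have h := Submodule.add_mem _ (hXraise j v hv) (hKt j v hv)
    rwa [LinearMap.sub_apply, sub_add_sub_cancel] at h
  have hRraise : ∀ j, ∀ v ∈ Φ j, R v ∈ Φ (j + 1) := hraise 1 R fun i hi u hu => by
    have h := hRU i hi u hu
    rcases Nat.lt_or_ge d (i + 1) with hi' | hi'
    · rw [hUzero _ hi', Submodule.mem_bot] at h
      rw [h]
      exact Submodule.zero_mem _
    · exact hUΦ _ hi' h
  have hMt : IsTriangular Φ (1 - (q * a) • K) fun j => 1 - q * a * κ j :=
    IsTriangular.one.sub (hKt.smul _)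
  have hNt : IsTriangular Φ (1 - (q⁻¹ * a) • K) fun j => 1 - q⁻¹ * a * κ j :=
    IsTriangular.one.sub (hKt.smul _)
  have hGraise : ∀ j, ∀ v ∈ Φ j,
      ((1 - (q * a) • K) * (X - K) + q • (K * R)) v ∈ Φ (j + 2) := by
    refine hraise 2 _ fun j hj u hu => ?_
    rcases hj.eq_or_lt with rfl | hlt
    · have h1 := hXraise j u (hUΦ j le_rfl hu)
      have h2 := hRraise j u (hUΦ j le_rfl hu)
      rw [hΦd _ (Nat.lt_succ_self j), Submodule.mem_bot] at h1 h2
      simp only [LinearMap.add_apply, Module.End.mul_apply, LinearMap.smul_apply, h1, h2,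
        map_zero, smul_zero, add_zero]
      exact Submodule.zero_mem _
    · have hθ0 : θ (j + 1) - θ j ≠ 0 :=
        sub_ne_zero.mpr (hθdist _ _ hlt hj (Nat.succ_ne_self j))
      have huΦ := hUΦ j hj hu
      have hy := hRU j hj u hu
      have hWu := sum_smul_congr_mod_projFlag hEE hEsum t θ hθ0 huΦ
      have hZu := sum_smul_congr_mod_projFlag hEE hEsum (fun i => (t i)⁻¹) θ hθ0 huΦ
      rw [← hW, ← hAE, ← hRA j hj u hu] at hWu
      rw [← hWinv, ← hAE, ← hRA j hj u hu] at hZu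
      have hZy := hZt (j + 1) _ (hUΦ _ hlt hy)
      have hKu := hKU' j u hu
      have hKy := hKU' _ _ hy
      have hcoeff := conj_subdiagonal_coeff_eq_zero hq0 ha0 (hκ0 (j + 1)) (ht0 j hj) (hts j hlt)
        (hκs j ▸ hθκ j hj) (hθκ (j + 1) hlt) hθ0
      rw [← hκs] at hcoeff
      set y := R u with hydef
      set μ := (t (j + 1) - t j) / (θ (j + 1) - θ j) with hμ
      set ν := ((t (j + 1))⁻¹ - (t j)⁻¹) / (θ (j + 1) - θ j) with hν
      set β := t j * κ j * ν + μ * κ (j + 1) * (t (j + 1))⁻¹ with hβ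
      have hXu : (X - K) u - β • y ∈ Φ (j + 2) := by
        have h1 := hZt.apply_mem hanti (hKt.apply_mem hanti hWu)
        have h2 := Submodule.smul_mem _ (t j * κ j) hZu
        have h3 := Submodule.smul_mem _ (μ * κ (j + 1)) hZy
        have h4 := Submodule.add_mem _ (Submodule.add_mem _ h1 h2) h3
        convert h4 using 1
        simp only [hX, LinearMap.sub_apply, Module.End.mul_apply, map_sub, map_add, map_smul,
          hKu, hKy, hβ]
        have h5 := ht0 j hj
        match_scalars <;> field_simp <;> ring
      have h := hMt.apply_mem hanti hXu
      convert h using 1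
      simp only [LinearMap.add_apply, LinearMap.sub_apply, LinearMap.smul_apply,
        Module.End.mul_apply, Module.End.one_apply, map_sub, map_smul, hKy, ← hydef]
      have h6 := congrArg (· • y) hcoeff
      simp only [zero_smul] at h6
      rw [← sub_eq_zero, ← h6]
      module
  have hG : (1 - (q * a) • K) * (X - K) + q • (K * R) = 0 := by
    refine eq_zero_of_intertwines_filtration d 2 projFlag_zero hΦd
      ((hAt.smul q).sub (hXt.smul (a * (q - q⁻¹))))
      ((hAt.smul q⁻¹).add (hKt.smul (a * (q - q⁻¹)))) hGraise
      (split_intertwines hq0 ha0 hKKinv hKinvK hRK hA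
        (quadratic_relation_conj hWZ hAW hAZ ?_ hZW)) fun i j hi hij => ?_
    · rw [hA]
      exact split_quadratic_relation hq0 ha0 hKKinv hKinvK hRK
    · rw [hθκ i hi, hθκ j (by omega)]
      refine intertwiner_weights_ne hq0 ha0 (hκ0 i) (hκ0 j) (fun h => ?_) fun h => ?_
      · refine hq2i (i - j - 1) (by omega) (by omega) ?_
        obtain ⟨n, rfl⟩ : ∃ n, i = j + 2 + n := ⟨i - (j + 2), by omega⟩
        refine mul_right_cancel₀ (hκ0 (j + 2 + n)) (mul_left_cancel₀ (pow_ne_zero 2 hq0) ?_)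
        rw [one_mul, ← h]
        simp only [hκ]
        rw [← zpow_natCast, ← zpow_natCast, ← zpow_add₀ hq0, ← zpow_add₀ hq0]
        congr 1
        rw [show j + 2 + n - j - 1 = n + 1 by omega]
        push_cast
        ring
      · refine ha2 ((i : ℤ) + j - d) (by omega) (by omega) ?_
        rw [mul_assoc] at h
        rw [eq_inv_of_mul_eq_one_left h]
        simp only [hκ]
        rw [← zpow_add₀ hq0, ← zpow_neg]
        congr 1
        ring
  have hH : (X - K) * (1 - (q⁻¹ * a) • K) + q⁻¹ • (R * K) = 0 := by
    refine eq_zero_of_intertwines_filtration d 1 (P := 0) (p := fun _ => 0) projFlag_zero hΦd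
      (fun j v _ => by simp) hMt (fun j v hv => ?_) ?_ fun i j hi hij h => ?_
    · exact Submodule.add_mem _ (hXraise j _ (hNt.apply_mem hanti hv))
        (Submodule.smul_mem _ _ (hRraise j _ (hKt.apply_mem hanti hv)))
    · rw [mul_zero, ← split_intertwines_symm hq0 hRK, hG, zero_mul]
    · have h1 : a * (q * κ i) = 1 := by linear_combination h
      refine ha2 (2 * (i : ℤ) - 1 - d) (by omega) (by omega) ?_
      rw [eq_inv_of_mul_eq_one_left h1]
      simp only [hκ]
      rw [← zpow_one_add₀ hq0, ← zpow_neg, ← zpow_natCast, ← zpow_mul]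
      congr 1
      push_cast
      ring
  exact ⟨first_identity_of_split ha0 hKKinv hA hAKW hG,
    second_identity_of_split ha0 hKinvK hA hAKW hH⟩
end

section
/- With the data below (which hold for the first split decomposition of a tridiagonal system of q-Racah type), the following identities hold in End(V): (q W^{-1}KW K^{-1} − q^{-1} K^{-1} W^{-1}KW)/(q − q^{-1}) = I and (q K WK^{-1}W^{-1} − q^{-1} WK^{-1}W^{-1} K)/(q − q^{-1}) = I. -/
section SplitDecomposition

variable {F V : Type*} [Field F] [AddCommGroup V] [Module F V]

/-- The sum of the subspaces `U m, U (m + 1), …, U d`. -/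
def tailSup (U : ℕ → Submodule F V) (d m : ℕ) : Submodule F V :=
  ⨆ j ∈ Finset.Icc m d, U j

lemma le_tailSup (U : ℕ → Submodule F V) {d m j : ℕ} (hm : m ≤ j) (hj : j ≤ d) :
    U j ≤ tailSup U d m :=
  le_iSup₂_of_le j (Finset.mem_Icc.2 ⟨hm, hj⟩) le_rfl

lemma tailSup_le {U : ℕ → Submodule F V} {d m : ℕ} {S : Submodule F V}
    (h : ∀ j, m ≤ j → j ≤ d → U j ≤ S) : tailSup U d m ≤ S :=
  iSup₂_le fun j hj => h j (Finset.mem_Icc.1 hj).1 (Finset.mem_Icc.1 hj).2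

lemma tailSup_anti (U : ℕ → Submodule F V) (d : ℕ) {m n : ℕ} (h : m ≤ n) :
    tailSup U d n ≤ tailSup U d m :=
  tailSup_le fun _ hn hj => le_tailSup U (h.trans hn) hj

lemma tailSup_eq_bot (U : ℕ → Submodule F V) {d m : ℕ} (h : d < m) : tailSup U d m = ⊥ :=
  le_bot_iff.1 (tailSup_le fun j hm hj => by omega)

/-- A map raising each `U j` by `n` steps raises each tail by `n` steps. -/
lemma map_mem_tailSup {U : ℕ → Submodule F V} {d n : ℕ} {T : Module.End F V}
    (hT : ∀ j ≤ d, ∀ u ∈ U j, T u ∈ tailSup U d (j + n)) (m : ℕ) {v : V}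
    (hv : v ∈ tailSup U d m) : T v ∈ tailSup U d (m + n) := by
  have h : tailSup U d m ≤ (tailSup U d (m + n)).comap T :=
    tailSup_le fun j hm hj u hu => tailSup_anti U d (by omega) (hT j hj u hu)
  exact h hv

/-- A map that is triangular on the `U j` with diagonal `τ` is so on the tails. -/
lemma map_sub_smul_mem_tailSup {U : ℕ → Submodule F V} {d : ℕ} {T : Module.End F V} {τ : ℕ → F}
    (hT : ∀ j ≤ d, ∀ u ∈ U j, T u - τ j • u ∈ tailSup U d (j + 1)) (m : ℕ) {v : V}
    (hv : v ∈ tailSup U d m) : T v - τ m • v ∈ tailSup U d (m + 1) := by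
  have h : tailSup U d m ≤ (tailSup U d (m + 1)).comap (T - τ m • 1) := by
    refine tailSup_le fun j hm hj u hu => ?_
    simp only [Submodule.mem_comap, LinearMap.sub_apply, LinearMap.smul_apply, Module.End.one_apply]
    rcases hm.eq_or_lt with rfl | hlt
    · exact hT _ hj u hu
    · have h1 := tailSup_anti U d (by omega : m + 1 ≤ j + 1) (hT j hj u hu)
      have h2 := (tailSup U d (m + 1)).smul_mem (τ j - τ m) (le_tailSup U hlt hj hu)
      convert add_mem h1 h2 using 1
      module
  simpa using h hv

/-- Endomorphisms agreeing on a spanning family of subspaces are equal. -/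
lemma end_ext_of_iSup_eq_top {U : ℕ → Submodule F V} {d : ℕ}
    (hU : (⨆ i ∈ Finset.range (d + 1), U i) = ⊤) {S T : Module.End F V}
    (h : ∀ j ≤ d, ∀ u ∈ U j, S u = T u) : S = T := by
  have h1 : (⨆ i ∈ Finset.range (d + 1), U i) ≤ LinearMap.eqLocus S T :=
    iSup₂_le fun j hj u hu => h j (Nat.lt_succ_iff.1 (Finset.mem_range.1 hj)) u hu
  ext v
  exact h1 (hU ▸ Submodule.mem_top)

/-- Linear maps prescribed on the summands of a direct sum decomposition glue. -/
lemma exists_end_of_iSupIndep {U : ℕ → Submodule F V} (hind : iSupIndep U)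
    (htop : (⨆ i, U i) = ⊤) (f : ℕ → Module.End F V) :
    ∃ T : Module.End F V, ∀ j, ∀ u ∈ U j, T u = f j u := by
  classical
  have hint := DirectSum.isInternal_submodule_of_iSupIndep_of_iSup_eq_top hind htop
  let e := LinearEquiv.ofBijective (DirectSum.coeLinearMap U) hint
  refine ⟨(DirectSum.toModule F ℕ V fun i => (f i).comp (U i).subtype).comp e.symm.toLinearMap,
    fun j u hu => ?_⟩
  have : e.symm u = DirectSum.lof F ℕ (fun i => U i) j ⟨u, hu⟩ := by
    rw [LinearEquiv.symm_apply_eq]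
    simp only [e]
    exact (DirectSum.coeLinearMap_lof U j ⟨u, hu⟩).symm
  simp [this]

/-- If `T` shifts the tails by two steps and satisfies a Sylvester type equation whose diagonal
coefficients do not vanish, then `T = 0`. -/
lemma eq_zero_of_sylvester {U : ℕ → Submodule F V} {d : ℕ}
    (hU : (⨆ i ∈ Finset.range (d + 1), U i) = ⊤) {A X K D : Module.End F V} {θ k : ℕ → F}
    {b c e : F}
    (hA : ∀ j ≤ d, ∀ u ∈ U j, A u - θ j • u ∈ tailSup U d (j + 1))
    (hX : ∀ j ≤ d, ∀ u ∈ U j, X u - k j • u ∈ tailSup U d (j + 1))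
    (hK : ∀ j ≤ d, ∀ u ∈ U j, K u - k j • u ∈ tailSup U d (j + 1))
    (hD : b • (D * A) - c • (A * D) = e • (D * X + K * D))
    (hD2 : ∀ j ≤ d, ∀ u ∈ U j, D u ∈ tailSup U d (j + 2))
    (hne : ∀ j n, 2 ≤ n → j + n ≤ d → b * θ j - c * θ (j + n) - e * (k j + k (j + n)) ≠ 0) :
    D = 0 := by
  have key : ∀ n, 2 ≤ n → ∀ j ≤ d, ∀ u ∈ U j, D u ∈ tailSup U d (j + n) := by
    intro n hn
    induction n, hn using Nat.le_induction with
    | base => exact hD2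
    | succ n hn ih =>
      intro j hj u hu
      have hw := ih j hj u hu
      by_cases hjn : j + n ≤ d
      · have h1 := map_mem_tailSup ih _ (hA j hj u hu)
        have h2 := map_mem_tailSup ih _ (hX j hj u hu)
        have h3 := map_sub_smul_mem_tailSup hA _ hw
        have h4 := map_sub_smul_mem_tailSup hK _ hw
        rw [show j + 1 + n = j + n + 1 by omega] at h1 h2
        rw [← add_assoc]
        rw [← Submodule.smul_mem_iff _ (hne j n hn hjn)]
        have hE := LinearMap.congr_fun hD u
        simp only [LinearMap.sub_apply, LinearMap.smul_apply, Module.End.mul_apply,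
          LinearMap.add_apply] at hE
        have h5 := add_mem (sub_mem (Submodule.smul_mem _ c h3) (Submodule.smul_mem _ b h1))
          (Submodule.smul_mem _ e (add_mem h2 h4))
        convert h5 using 1
        rw [map_sub, map_smul, map_sub, map_smul]
        linear_combination (norm := module) (1 : F) • hE
      · rw [tailSup_eq_bot U (by omega)] at hw
        rw [(Submodule.mem_bot F).1 hw]
        exact zero_mem _
  refine end_ext_of_iSup_eq_top hU fun j hj u hu => ?_
  have h := key (d + 2) (by omega) j hj u hu
  rw [tailSup_eq_bot U (by omega)] at h
  simpa using h

end SplitDecomposition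

/-- A linear combination of orthogonal idempotents acts on each of them by its coefficient. -/
lemma sum_smul_mul_of_orthogonal {F R : Type*} [Field F] [Ring R] [Algebra F R] {d : ℕ}
    {E : ℕ → R} (hEE : ∀ i j : ℕ, i ≤ d → j ≤ d → E i * E j = if i = j then E i else 0)
    (s : ℕ → F) {j : ℕ} (hj : j ≤ d) :
    (∑ i ∈ Finset.range (d + 1), s i • E i) * E j = s j • E j := by
  rw [Finset.sum_mul, Finset.sum_eq_single_of_mem j (Finset.mem_range.2 (by omega))]
  · simp [hEE j j hj hj]
  · intro i hi hij
    simp [hEE i j (Nat.lt_succ_iff.1 (Finset.mem_range.1 hi)) hj, hij]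

/-- Products of linear combinations of orthogonal idempotents are computed coefficientwise. -/
lemma sum_smul_mul_sum_smul_of_orthogonal {F R : Type*} [Field F] [Ring R] [Algebra F R] {d : ℕ}
    {E : ℕ → R} (hEE : ∀ i j : ℕ, i ≤ d → j ≤ d → E i * E j = if i = j then E i else 0)
    (s r : ℕ → F) :
    (∑ i ∈ Finset.range (d + 1), s i • E i) * (∑ i ∈ Finset.range (d + 1), r i • E i) =
      ∑ i ∈ Finset.range (d + 1), (s i * r i) • E i := by
  rw [Finset.mul_sum]
  refine Finset.sum_congr rfl fun j hj => ?_
  rw [mul_smul_comm, sum_smul_mul_of_orthogonal hEE s (Nat.lt_succ_iff.1 (Finset.mem_range.1 hj)),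
    smul_smul, mul_comm]


theorem stmt19
    {F : Type*} [Field F] {V : Type*} [AddCommGroup V] [Module F V]
    [FiniteDimensional F V] [Nontrivial V]
    (q a : F) (hq0 : q ≠ 0) (ha0 : a ≠ 0) (hq4 : q ^ 4 ≠ 1)
    (d : ℕ) (hd : 1 ≤ d)
    (hq2i : ∀ i : ℕ, 1 ≤ i → i ≤ d → q ^ (2 * i) ≠ 1)
    (ha2 : ∀ j : ℤ, 1 - (d : ℤ) ≤ j → j ≤ (d : ℤ) - 1 → a ^ 2 ≠ q ^ (2 * j))
    (θ : ℕ → F)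
    (hθ : ∀ i : ℕ, i ≤ d → θ i = a * q ^ ((d : ℤ) - 2 * (i : ℤ)) + a⁻¹ * q ^ (2 * (i : ℤ) - (d : ℤ)))
    (hθdist : ∀ i j : ℕ, i ≤ d → j ≤ d → i ≠ j → θ i ≠ θ j)
    (A : Module.End F V) (E : ℕ → Module.End F V)
    (hEE : ∀ i j : ℕ, i ≤ d → j ≤ d → E i * E j = if i = j then E i else 0)
    (hEsum : ∑ i ∈ Finset.range (d + 1), E i = 1)
    (hAE : A = ∑ i ∈ Finset.range (d + 1), θ i • E i)
    (hEne : ∀ i : ℕ, i ≤ d → E i ≠ 0)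
    (t : ℕ → F)
    (ht : ∀ i : ℕ, i ≤ d → t i = (-1 : F) ^ i * a ^ i * q ^ (i * (d - i)))
    (W Winv : Module.End F V)
    (hW : W = ∑ i ∈ Finset.range (d + 1), t i • E i)
    (hWinv : Winv = ∑ i ∈ Finset.range (d + 1), (t i)⁻¹ • E i)
    (U : ℕ → Submodule F V)
    (hUne : ∀ i : ℕ, i ≤ d → U i ≠ ⊥)
    (hUzero : ∀ i : ℕ, d < i → U i = ⊥)
    (hUind : iSupIndep U)
    (hUtop : (⨆ i ∈ Finset.range (d + 1), U i) = ⊤)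
    (hUsplit : ∀ i : ℕ, i ≤ d →
      (⨆ j ∈ Finset.Icc i d, U j) = ⨆ j ∈ Finset.Icc i d, LinearMap.range (E j))
    (hAU : ∀ i : ℕ, i < d → ∀ v ∈ U i, (A - θ i • 1) v ∈ U (i + 1))
    (hAUd : ∀ v ∈ U d, (A - θ d • 1) v = 0)
    (K Kinv : Module.End F V)
    (hKKinv : K * Kinv = 1) (hKinvK : Kinv * K = 1)
    (hKU : ∀ i : ℕ, i ≤ d → ∀ v ∈ U i, K v = (q ^ ((d : ℤ) - 2 * (i : ℤ))) • v)
    (hAKW : A = a • (Winv * K * W) + a⁻¹ • (W * Kinv * Winv)) :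
    (q - q⁻¹)⁻¹ • (q • (Winv * K * W * Kinv) - q⁻¹ • (Kinv * (Winv * K * W))) = 1 ∧
    (q - q⁻¹)⁻¹ • (q • (K * (W * Kinv * Winv)) - q⁻¹ • (W * Kinv * Winv * K)) = 1 := by

  have hq2 : q ^ 2 ≠ 1 := by simpa using hq2i 1 le_rfl hd
  have hqq : q - q⁻¹ ≠ 0 := by
    intro h
    apply hq2
    field_simp at h
    linear_combination h
  set k : ℕ → F := fun i => q ^ ((d : ℤ) - 2 * (i : ℤ)) with hk
  have hKk : ∀ i ≤ d, ∀ v ∈ U i, K v = k i • v := hKU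
  have hk0 : ∀ i, k i ≠ 0 := fun i => zpow_ne_zero _ hq0
  have hkadd : ∀ j n, k (j + n) = k j / q ^ (2 * n) := by
    intro j n
    simp only [hk]
    rw [← zpow_natCast q (2 * n), ← zpow_sub₀ hq0]
    congr 1
    push_cast
    ring
  have hks : ∀ j, k (j + 1) = k j / q ^ 2 := fun j => by simpa using hkadd j 1
  have hθk : ∀ i ≤ d, θ i = a * k i + a⁻¹ * (k i)⁻¹ := by
    intro i hi
    rw [hθ i hi]
    simp only [hk]
    rw [← zpow_neg, neg_sub]
  have hak : ∀ j n, 1 ≤ n → j + n ≤ d → a ^ 2 * k j ^ 2 ≠ q ^ (2 * n) := by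
    intro j n hn hjn h
    refine ha2 (n - d + 2 * j) (by omega) (by omega) ?_
    have h1 : q ^ (2 * ((n : ℤ) - d + 2 * j)) = q ^ (2 * n) / k j ^ 2 := by
      simp only [hk]
      rw [← zpow_natCast q (2 * n), ← zpow_natCast _ 2, ← zpow_mul, ← zpow_sub₀ hq0]
      congr 1
      push_cast
      ring
    rw [h1, ← h]
    field_simp [hk0 j]
  have hak1 : ∀ j, j + 1 ≤ d → a * k j - q ≠ 0 ∧ a * k j + q ≠ 0 := by
    intro j hj
    have h := hak j 1 le_rfl hj
    constructor <;> intro h' <;> apply h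
    · linear_combination (a * k j + q) * h'
    · linear_combination (a * k j - q) * h'
  have htne : ∀ i ≤ d, t i ≠ 0 := by
    intro i hi
    rw [ht i hi]
    exact mul_ne_zero (mul_ne_zero (pow_ne_zero _ (by simp)) (pow_ne_zero _ ha0))
      (pow_ne_zero _ hq0)
  have hts : ∀ j, j + 1 ≤ d → t (j + 1) = -(a * k j / q) * t j := by
    intro j hj
    rw [ht j (by omega), ht (j + 1) hj]
    obtain ⟨m, rfl⟩ := Nat.exists_eq_add_of_le hj
    have h1 : k j = q ^ (m + 1) / q ^ j := by
      simp only [hk]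
      rw [← zpow_natCast, ← zpow_natCast, ← zpow_sub₀ hq0]
      congr 1
      push_cast
      ring
    rw [h1, show j + 1 + m - (j + 1) = m by omega, show j + 1 + m - j = m + 1 by omega]
    field_simp
    ring
  clear_value k
  have hWE : ∀ j ≤ d, W * E j = t j • E j := fun j hj => by
    rw [hW]; exact sum_smul_mul_of_orthogonal hEE t hj
  have hWW : Winv * W = 1 := by
    rw [hW, hWinv, sum_smul_mul_sum_smul_of_orthogonal hEE, ← hEsum]
    refine Finset.sum_congr rfl fun i hi => ?_
    rw [inv_mul_cancel₀ (htne i (Nat.lt_succ_iff.1 (Finset.mem_range.1 hi))), one_smul]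
  have hWW' : W * Winv = 1 := by
    rw [hW, hWinv, sum_smul_mul_sum_smul_of_orthogonal hEE, ← hEsum]
    refine Finset.sum_congr rfl fun i hi => ?_
    rw [mul_inv_cancel₀ (htne i (Nat.lt_succ_iff.1 (Finset.mem_range.1 hi))), one_smul]
  have hAW : A * W = W * A := by
    rw [hW, hAE, sum_smul_mul_sum_smul_of_orthogonal hEE, sum_smul_mul_sum_smul_of_orthogonal hEE]
    simp only [mul_comm]
  have hWtri : ∀ j ≤ d, ∀ u ∈ U j, W u - t j • u ∈ tailSup U d (j + 1) := by
    intro j hj u hu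
    have hle : (⨆ i ∈ Finset.Icc j d, LinearMap.range (E i)) ≤
        (tailSup U d (j + 1)).comap (W - t j • 1) := by
      refine iSup₂_le fun i hi => ?_
      rw [Finset.mem_Icc] at hi
      rintro _ ⟨w, rfl⟩
      have h1 : W (E i w) = t i • E i w := LinearMap.congr_fun (hWE i hi.2) w
      simp only [Submodule.mem_comap, LinearMap.sub_apply, LinearMap.smul_apply,
        Module.End.one_apply, h1, ← sub_smul]
      rcases hi.1.eq_or_lt with rfl | hlt
      · simp
      · refine Submodule.smul_mem _ _ ?_
        rw [tailSup, hUsplit (j + 1) (by omega)]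
        exact Submodule.mem_iSup_of_mem i (Submodule.mem_iSup_of_mem
          (Finset.mem_Icc.2 ⟨hlt, hi.2⟩) ⟨w, rfl⟩)
    have := hle ((hUsplit j hj).le (le_tailSup U le_rfl hj hu))
    simpa using this
  have hraise : ∀ j ≤ d, ∀ u ∈ U j, A u - θ j • u ∈ U (j + 1) := by
    intro j hj u hu
    rcases hj.eq_or_lt with rfl | hlt
    · have := hAUd u hu
      simp only [LinearMap.sub_apply, LinearMap.smul_apply, Module.End.one_apply] at this
      rw [this]
      exact zero_mem _
    · simpa using hAU j hlt u hu
  have hUtail : ∀ j, ∀ u ∈ U j, u ∈ tailSup U d j := by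
    intro j u hu
    by_cases hj : j ≤ d
    · exact le_tailSup U le_rfl hj hu
    · rw [hUzero j (by omega)] at hu
      rw [(Submodule.mem_bot F).1 hu]
      exact zero_mem _
  have hAtri : ∀ j ≤ d, ∀ u ∈ U j, A u - θ j • u ∈ tailSup U d (j + 1) := fun j hj u hu =>
    hUtail _ _ (hraise j hj u hu)
  have hKtri : ∀ j ≤ d, ∀ u ∈ U j, K u - k j • u ∈ tailSup U d (j + 1) := fun j hj u hu => by
    rw [hKk j hj u hu, sub_self]
    exact zero_mem _
  have hKKU : ∀ j ≤ d, ∀ u ∈ U j, Kinv u = (k j)⁻¹ • u := by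
    intro j hj u hu
    have h := congrArg Kinv (hKk j hj u hu)
    rw [← Module.End.mul_apply, hKinvK, map_smul, Module.End.one_apply] at h
    rw [eq_inv_smul_iff₀ (hk0 j)]
    exact h.symm
  have hUtop' : (⨆ i, U i) = ⊤ :=
    top_le_iff.1 (hUtop ▸ iSup₂_le fun i _ => le_iSup U i)
  set x : ℕ → F := fun j => k j / (a * k j - q) with hx
  obtain ⟨X, hX⟩ := exists_end_of_iSupIndep hUind hUtop'
    fun j => k j • 1 + x j • (A - θ j • 1)
  replace hX : ∀ j, ∀ u ∈ U j, X u = k j • u + x j • (A u - θ j • u) := fun j u hu => by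
    simpa using hX j u hu
  have hXtri : ∀ j ≤ d, ∀ u ∈ U j, X u - k j • u ∈ tailSup U d (j + 1) := fun j hj u hu => by
    rw [hX j u hu, add_sub_cancel_left]
    exact Submodule.smul_mem _ _ (hAtri j hj u hu)
  have hKA : q • (K * A) - q⁻¹ • (A * K) = (q - q⁻¹) • (a • (K * K) + a⁻¹ • 1) := by
    refine end_ext_of_iSup_eq_top hUtop fun j hj u hu => ?_
    have hr := hraise j hj u hu
    obtain ⟨r, hr'⟩ : ∃ r, r = A u - θ j • u := ⟨_, rfl⟩
    rw [← hr'] at hr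
    have hAu : A u = θ j • u + r := by rw [hr']; abel
    have hKr : K r = k (j + 1) • r := by
      by_cases h : j + 1 ≤ d
      · exact hKk _ h r hr
      · rw [hUzero _ (by omega)] at hr
        simp [(Submodule.mem_bot F).1 hr]
    have hKu : K u = k j • u := hKk j hj u hu
    simp only [LinearMap.sub_apply, LinearMap.smul_apply, Module.End.mul_apply,
      LinearMap.add_apply, Module.End.one_apply, hAu, hKu, map_add, map_smul, hKr]
    rw [hks, hθk j hj]
    match_scalars
    · field_simp [hk0 j]
    · field_simp
      ring
  have hXA : q • (X * A) - q⁻¹ • (A * X) = (q - q⁻¹) • (a • (X * X) + a⁻¹ • 1) := by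
    refine end_ext_of_iSup_eq_top hUtop fun j hj u hu => ?_
    have hr := hraise j hj u hu
    obtain ⟨r, hr'⟩ : ∃ r, r = A u - θ j • u := ⟨_, rfl⟩
    rw [← hr'] at hr
    have hAu : A u = θ j • u + r := by rw [hr']; abel
    have hXu : X u = k j • u + x j • r := by rw [hX j u hu, hr']
    by_cases hj1 : j + 1 ≤ d
    · have hs := hraise (j + 1) hj1 r hr
      obtain ⟨s, hs'⟩ : ∃ s, s = A r - θ (j + 1) • r := ⟨_, rfl⟩
      rw [← hs'] at hs
      have hAr : A r = θ (j + 1) • r + s := by rw [hs']; abel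
      have hXr : X r = k (j + 1) • r + x (j + 1) • s := by rw [hX _ r hr, hs']
      have hxs : (q * x (j + 1) - q⁻¹ * x j - (q - q⁻¹) * a * (x j * x (j + 1))) • s = 0 := by
        by_cases hj2 : j + 2 ≤ d
        · convert zero_smul F s using 2
          have h1 := (hak1 j hj1).1
          have h2 := (hak1 (j + 1) hj2).1
          simp only [hx]
          rw [hks] at h2 ⊢
          have h3 : a * k j - q ^ 3 ≠ 0 := by
            intro h
            apply h2
            field_simp
            linear_combination h
          rw [show a * (k j / q ^ 2) - q = (a * k j - q ^ 3) / q ^ 2 by field_simp]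
          have h4 := hk0 j
          generalize k j = κ at h1 h3 h4 ⊢
          rw [mul_comm a κ] at h1 h3 ⊢
          field_simp
          ring
        · rw [hUzero _ (by omega)] at hs
          rw [(Submodule.mem_bot F).1 hs, smul_zero]
      have hrc : q * (θ j * x j + k (j + 1)) - q⁻¹ * (k j + x j * θ (j + 1)) =
          (q - q⁻¹) * a * (k j * x j + x j * k (j + 1)) := by
        rw [hθk j hj, hθk _ hj1, hks]
        field_simp [hk0 j]
        ring
      have huc : q * (θ j * k j) - q⁻¹ * (k j * θ j) = (q - q⁻¹) * (a * k j ^ 2 + a⁻¹) := by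
        rw [hθk j hj]
        field_simp [hk0 j]
      simp only [LinearMap.sub_apply, LinearMap.smul_apply, Module.End.mul_apply,
        LinearMap.add_apply, Module.End.one_apply, hAu, hXu, map_add, map_smul, hXr, hAr]
      linear_combination (norm := module) huc • u + hrc • r + hxs
    · rw [hUzero _ (by omega)] at hr
      rw [(Submodule.mem_bot F).1 hr, add_zero] at hAu
      rw [(Submodule.mem_bot F).1 hr, smul_zero, add_zero] at hXu
      simp only [LinearMap.sub_apply, LinearMap.smul_apply, Module.End.mul_apply,
        LinearMap.add_apply, Module.End.one_apply, hAu, hXu, map_smul]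
      rw [hθk j hj]
      match_scalars
      field_simp [hk0 j]
  have hWX : W * X - K * W = 0 := by
    refine eq_zero_of_sylvester (b := q) (c := q⁻¹) (e := (q - q⁻¹) * a) hUtop hAtri hXtri hKtri
      ?_ ?_ ?_
    · have h1 := congrArg (W * ·) hXA
      have h2 := congrArg (· * W) hKA
      simp only [mul_sub, sub_mul, mul_add, add_mul, mul_smul_comm, smul_mul_assoc, mul_one,
        one_mul, mul_assoc, hAW] at h1 h2 ⊢
      simp only [← mul_assoc, hAW] at h1 h2 ⊢
      linear_combination (norm := module) (1 : F) • h1 - (1 : F) • h2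
    · intro j hj u hu
      have hr := hraise j hj u hu
      obtain ⟨r, hr'⟩ : ∃ r, r = A u - θ j • u := ⟨_, rfl⟩
      rw [← hr'] at hr
      have hAu : A u = θ j • u + r := by rw [hr']; abel
      have hXu : X u = k j • u + x j • r := by rw [hX j u hu, hr']
      have hy := hWtri j hj u hu
      obtain ⟨y, hy'⟩ : ∃ y, y = W u - t j • u := ⟨_, rfl⟩
      rw [← hy'] at hy
      have hWu : W u = t j • u + y := by rw [hy']; abel
      have hKu : K u = k j • u := hKk j hj u hu
      have hWr := map_sub_smul_mem_tailSup hWtri _ (hUtail _ r hr)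
      have hAy := map_sub_smul_mem_tailSup hAtri _ hy
      have hKy := map_sub_smul_mem_tailSup hKtri _ hy
      by_cases hj1 : j + 1 ≤ d
      · have hcomm := LinearMap.congr_fun hAW u
        simp only [Module.End.mul_apply, hWu, hAu, map_add, map_smul] at hcomm
        have hθne : θ (j + 1) - θ j ≠ 0 :=
          sub_ne_zero.2 (hθdist _ _ hj1 hj (by omega))
        have hyr : y - ((t (j + 1) - t j) / (θ (j + 1) - θ j)) • r ∈ tailSup U d (j + 1 + 1) := by
          rw [← Submodule.smul_mem_iff _ hθne, smul_sub, smul_smul, mul_div_cancel₀ _ hθne]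
          convert sub_mem hWr hAy using 1
          linear_combination (norm := module) hcomm
        have hc : x j * t (j + 1) +
            (k j - k (j + 1)) * ((t (j + 1) - t j) / (θ (j + 1) - θ j)) = 0 := by
          have h1 := (hak1 j hj1).1
          have h2 := (hak1 j hj1).2
          have h3 : q ^ 2 - 1 ≠ 0 := sub_ne_zero.2 hq2
          have h4 := hk0 j
          have h5 : θ (j + 1) - θ j =
              -((q ^ 2 - 1) * (a * k j - q) * (a * k j + q) / (a * k j * q ^ 2)) := by
            rw [hθk j hj, hθk _ hj1, hks]
            field_simp
            ring
          rw [h5, hts j hj1, hks]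
          simp only [hx]
          generalize k j = κ at h1 h2 h4 ⊢
          rw [mul_comm a κ] at h1 h2 ⊢
          field_simp
          ring
        have hfin := sub_mem (add_mem (Submodule.smul_mem _ (x j) hWr)
          (Submodule.smul_mem _ (k j - k (j + 1)) hyr)) hKy
        convert hfin using 1
        simp only [LinearMap.sub_apply, Module.End.mul_apply, hWu, hXu, map_add, map_smul, hKu]
        linear_combination (norm := module) hc • r
      · rw [hUzero _ (by omega)] at hr
        rw [tailSup_eq_bot U (by omega)] at hy
        simp only [LinearMap.sub_apply, Module.End.mul_apply, hWu, hXu, map_smul, hKu,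
          (Submodule.mem_bot F).1 hr, (Submodule.mem_bot F).1 hy, smul_zero, add_zero]
        convert zero_mem (tailSup U d (j + 2)) using 1
        module
    · intro j n hn hjn h
      have h1 : q ^ (2 * (n - 1)) ≠ 1 := hq2i (n - 1) (by omega) (by omega)
      have h2 := hak j n (by omega) hjn
      have h3 : q ^ (2 * n) = q ^ (2 * (n - 1)) * q ^ 2 := by
        rw [← pow_add]
        congr 1
        omega
      rw [hθk j (by omega), hθk _ hjn, hkadd] at h
      rw [h3] at h h2
      have h4 : q ^ (2 * (n - 1)) ≠ 0 := pow_ne_zero _ hq0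
      generalize q ^ (2 * (n - 1)) = p at h h1 h2 h4
      have h5 := hk0 j
      generalize k j = κ at h h2 h5
      field_simp at h
      have h6 : q ^ 2 * ((p - 1) * (a ^ 2 * κ ^ 2 - p * q ^ 2)) = 0 := by
        linear_combination h
      exact mul_ne_zero (pow_ne_zero 2 hq0)
        (mul_ne_zero (sub_ne_zero.2 h1) (sub_ne_zero.2 h2)) h6
  have hXW : Winv * K * W = X := by
    rw [mul_assoc, ← sub_eq_zero.1 hWX, ← mul_assoc, hWW, one_mul]
  have hmain : (q - q⁻¹)⁻¹ • (q • (Winv * K * W * Kinv) - q⁻¹ • (Kinv * (Winv * K * W))) = 1 := by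
    rw [hXW]
    refine end_ext_of_iSup_eq_top hUtop fun j hj u hu => ?_
    have hr := hraise j hj u hu
    obtain ⟨r, hr'⟩ : ∃ r, r = A u - θ j • u := ⟨_, rfl⟩
    rw [← hr'] at hr
    have hXu : X u = k j • u + x j • r := by rw [hX j u hu, hr']
    have hKr : Kinv r = (k (j + 1))⁻¹ • r := by
      by_cases h : j + 1 ≤ d
      · exact hKKU _ h r hr
      · rw [hUzero _ (by omega)] at hr
        simp [(Submodule.mem_bot F).1 hr]
    simp only [LinearMap.sub_apply, LinearMap.smul_apply, Module.End.mul_apply,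
      Module.End.one_apply, hKKU j hj u hu, hXu, map_add, map_smul, hKr]
    rw [inv_smul_eq_iff₀ hqq, hks]
    have h4 := hk0 j
    match_scalars
    · field_simp
    · field_simp
      ring
  refine ⟨hmain, ?_⟩
  have h := congrArg (fun T => W * T * Winv) hmain
  simp only [mul_one, hWW', mul_smul_comm, smul_mul_assoc, mul_sub, sub_mul] at h
  rw [← h]
  congr 3
  · simp only [← mul_assoc, hWW', one_mul]
  · simp only [mul_assoc, hWW', mul_one]
end
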